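/- Let d ∈ {5, 6, 10, 13, 15, 22, 35, 37, 51, 58, 91, 115, 123, 187, 235, 267, 403, 427}, and set c₂(d) = 2 if d = 15, c₂(d) = 3 if d = 35, c₂(d) = 5/3 if d = 91, c₂(d) = 7/3 if d = 187, c₂(d) = 11/9 if d = 403, and c₂(d) = 1/2 otherwise. Define b_d : {positive integers} → ℚ by b_d(m) = (1/2)·∑_{(a,b) ∈ S_d(m)} V_d(a,b) + c₂(d)·∑_{(x,y) ∈ S^a_d(m)} V^a_d(x,y). Then b_d(1) = 1; b_d(m·n) = b_d(m)·b_d(n) for all coprime positive integers m, n; and for every prime p such that either p is odd and the Legendre symbol (d_K/p) = 1, or p = 2 and d_K ≡ 1 (mod 8), and every integer α ≥ 1, one has b_d(p^{α+1}) = b_d(p)·b_d(p^α) − p²·b_d(p^{α−1}). -/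

import Mathlib

/-- The norm form `Q_d` of the principal ideal class of `ℚ(√−d)` on `ℤ²`:
`a² + d·b²` if `d ≡ 1, 2 (mod 4)`, and `a² + a·b + ((1+d)/4)·b²` if `d ≡ 3 (mod 4)`. -/
def Qf (d : ℕ) (p : ℤ × ℤ) : ℤ :=
  if d % 4 = 3 then p.1 ^ 2 + p.1 * p.2 + (((1 + d) / 4 : ℕ) : ℤ) * p.2 ^ 2
  else p.1 ^ 2 + (d : ℤ) * p.2 ^ 2

/-- The value `V_d(a,b)` of the harmonic polynomial `x² − y²` at the point of `ℝ² = ℂ`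
corresponding to `(a,b)` under the standard embedding of the ring of integers of `ℚ(√−d)`. -/
def Vf (d : ℕ) (p : ℤ × ℤ) : ℚ :=
  if d % 4 = 3 then ((2 * (p.1 : ℚ) + (p.2 : ℚ)) ^ 2 - (d : ℚ) * (p.2 : ℚ) ^ 2) / 4
  else (p.1 : ℚ) ^ 2 - (d : ℚ) * (p.2 : ℚ) ^ 2

/-- The shell of norm `m` of `L_o`: `S_d(m) = {(a,b) ∈ ℤ × ℤ : Q_d(a,b) = m}`. -/
def shell (d m : ℕ) : Set (ℤ × ℤ) := {p | Qf d p = (m : ℤ)}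

/-- The coefficients `(A, B, C)` of the reduced binary quadratic form
`f_d(x,y) = A·x² + B·x·y + C·y²` attached to the nonprincipal ideal class of `ℚ(√−d)`,
for each squarefree `d` with class number 2. -/
def npABC (d : ℕ) : ℤ × ℤ × ℤ :=
  if d = 5 then (2, 2, 3)
  else if d = 6 then (2, 0, 3)
  else if d = 10 then (2, 0, 5)
  else if d = 13 then (2, 2, 7)
  else if d = 15 then (2, 1, 2)
  else if d = 22 then (2, 0, 11)
  else if d = 35 then (3, 1, 3)
  else if d = 37 then (2, 2, 19)
  else if d = 51 then (3, 3, 5)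
  else if d = 58 then (2, 0, 29)
  else if d = 91 then (5, 3, 5)
  else if d = 115 then (5, 5, 7)
  else if d = 123 then (3, 3, 11)
  else if d = 187 then (7, 3, 7)
  else if d = 235 then (5, 5, 13)
  else if d = 267 then (3, 3, 23)
  else if d = 403 then (11, 9, 11)
  else (7, 7, 17)

/-- The nonprincipal form `f_d(x,y) = A·x² + B·x·y + C·y²`. -/
def fnp (d : ℕ) (p : ℤ × ℤ) : ℤ :=
  (npABC d).1 * p.1 ^ 2 + (npABC d).2.1 * p.1 * p.2 + (npABC d).2.2 * p.2 ^ 2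

/-- The value `V^a_d(x,y) = ((2Ax+By)² + (B²−4AC)·y²)/(4A)` of the harmonic polynomial
`x² − y²` at the point of the lattice `L_a` corresponding to `(x,y) ∈ ℤ²`. -/
def Vnp (d : ℕ) (p : ℤ × ℤ) : ℚ :=
  (((2 * (npABC d).1 * p.1 + (npABC d).2.1 * p.2) ^ 2
      + ((npABC d).2.1 ^ 2 - 4 * (npABC d).1 * (npABC d).2.2) * p.2 ^ 2 : ℤ) : ℚ)
    / (4 * ((npABC d).1 : ℚ))

/-- The shell of norm `m` of `L_a`: `S^a_d(m) = {(x,y) ∈ ℤ × ℤ : f_d(x,y) = m}`. -/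
def shellNp (d m : ℕ) : Set (ℤ × ℤ) := {p | fnp d p = (m : ℤ)}

/-- The discriminant `d_K` of `ℚ(√−d)` for a squarefree positive integer `d`:
`−4d` if `d ≡ 1, 2 (mod 4)` and `−d` if `d ≡ 3 (mod 4)`. -/
def discK (d : ℕ) : ℤ := if d % 4 = 3 then -(d : ℤ) else -4 * (d : ℤ)

/-- The constant `c₂(d)`: `2` if `d = 15`, `3` if `d = 35`, `5/3` if `d = 91`,
`7/3` if `d = 187`, `11/9` if `d = 403`, and `1/2` otherwise. -/
def c2 (d : ℕ) : ℚ :=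
  if d = 15 then 2
  else if d = 35 then 3
  else if d = 91 then 5 / 3
  else if d = 187 then 7 / 3
  else if d = 403 then 11 / 9
  else 1 / 2

structure GD where
  A : ℤ
  δ : ℤ
  C : ℤ
  r : ℂ
  τ : ℂ
  hA : Prime A
  hA0 : 0 < A
  hr : r * r = A
  hrc : starRingEnd ℂ r = r
  htr : τ + starRingEnd ℂ τ = δ * r
  hnm : τ * starRingEnd ℂ τ = C
  hQ : 3 ≤ 4 * C - A * δ ^ 2
  hQ4 : 4 * C - A * δ ^ 2 ≠ 4
  hAC : ¬ A ∣ C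
  hCP : ∀ a b c : ℤ, 0 < a → b ^ 2 - 4 * a * c = A ^ 2 * δ ^ 2 - 4 * A * C →
    ∃ x y : ℤ, a * x ^ 2 + b * x * y + c * y ^ 2 = 1 ∨ a * x ^ 2 + b * x * y + c * y ^ 2 = A

namespace GD
variable (g : GD)

def el (i : Bool) (x y : ℤ) : ℂ := if i then x * g.r + y * g.τ else x + y * (g.r * g.τ)

def nm (i : Bool) (x y : ℤ) : ℤ :=
  if i then g.A * x ^ 2 + g.A * g.δ * x * y + g.C * y ^ 2
  else x ^ 2 + g.A * g.δ * x * y + g.A * g.C * y ^ 2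

def Gp (i : Bool) (z : ℂ) : Prop := ∃ x y : ℤ, z = g.el i x y

def G (z : ℂ) : Prop := ∃ i, g.Gp i z

lemma tsq : g.τ * g.τ = g.δ * g.r * g.τ - g.C := by
  have h1 := g.htr
  have h2 := g.hnm
  linear_combination g.τ * h1 - h2

lemma cjt : starRingEnd ℂ g.τ = g.δ * g.r - g.τ := by
  linear_combination g.htr

lemma el_norm (i : Bool) (x y : ℤ) :
    g.el i x y * starRingEnd ℂ (g.el i x y) = (g.nm i x y : ℂ) := by
  have h1 := g.hr
  have h2 := g.tsq
  cases i
  · simp [GD.el, nm, g.hrc, g.cjt]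
    linear_combination (x * y * g.δ + y ^ 2 * (g.δ * g.r * g.τ - g.τ * g.τ)) * h1 - y ^ 2 * g.A * h2
  · simp [GD.el, nm, g.hrc, g.cjt]
    linear_combination (x ^ 2 + x * y * g.δ) * h1 - y ^ 2 * h2

variable {g}

lemma Gp.el (i : Bool) (x y : ℤ) : g.Gp i (g.el i x y) := ⟨x, y, rfl⟩

lemma Gp.add {i : Bool} {z w : ℂ} (hz : g.Gp i z) (hw : g.Gp i w) : g.Gp i (z + w) := by
  obtain ⟨x, y, rfl⟩ := hz
  obtain ⟨x', y', rfl⟩ := hw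
  refine ⟨x + x', y + y', ?_⟩
  cases i <;> simp [GD.el] <;> ring

lemma Gp.zmul {i : Bool} {z : ℂ} (n : ℤ) (hz : g.Gp i z) : g.Gp i (n * z) := by
  obtain ⟨x, y, rfl⟩ := hz
  refine ⟨n * x, n * y, ?_⟩
  cases i <;> simp [GD.el] <;> ring

lemma Gp.neg {i : Bool} {z : ℂ} (hz : g.Gp i z) : g.Gp i (-z) := by
  have := hz.zmul (-1)
  simpa using this

lemma Gp.sub {i : Bool} {z w : ℂ} (hz : g.Gp i z) (hw : g.Gp i w) : g.Gp i (z - w) := by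
  rw [sub_eq_add_neg]; exact hz.add hw.neg

lemma Gp.mul {i j : Bool} {z w : ℂ} (hz : g.Gp i z) (hw : g.Gp j w) :
    g.Gp (xor i j) (z * w) := by
  have h1 := g.hr
  have h2 := g.tsq
  obtain ⟨x, y, rfl⟩ := hz
  obtain ⟨u, v, rfl⟩ := hw
  cases i <;> cases j
  · refine ⟨x * u - g.A * g.C * y * v, x * v + y * u + g.A * g.δ * y * v, ?_⟩
    simp [GD.el]
    linear_combination (y * v * g.τ * g.τ) * h1 + y * v * g.A * h2
  · refine ⟨x * u - g.C * y * v, x * v + g.A * y * u + g.A * g.δ * y * v, ?_⟩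
    simp [GD.el]
    linear_combination (y * u * g.τ + y * v * g.δ * g.τ) * h1 + y * v * g.r * h2
  · refine ⟨x * u - g.C * y * v, g.A * x * v + y * u + g.A * g.δ * y * v, ?_⟩
    simp [GD.el]
    linear_combination (x * v * g.τ + y * v * g.δ * g.τ) * h1 + y * v * g.r * h2
  · refine ⟨g.A * x * u - g.C * y * v, x * v + y * u + g.δ * y * v, ?_⟩
    simp [GD.el]
    linear_combination (x * u) * h1 + y * v * h2

lemma Gp.conj {i : Bool} {z : ℂ} (hz : g.Gp i z) : g.Gp i (starRingEnd ℂ z) := by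
  have h1 := g.hr
  obtain ⟨x, y, rfl⟩ := hz
  cases i
  · refine ⟨x + g.A * g.δ * y, -y, ?_⟩
    simp [GD.el, g.hrc, g.cjt]
    linear_combination (y * g.δ) * h1
  · refine ⟨x + g.δ * y, -y, ?_⟩
    simp [GD.el, g.hrc, g.cjt]
    ring

lemma G.mul {z w : ℂ} (hz : g.G z) (hw : g.G w) : g.G (z * w) := by
  obtain ⟨i, hz⟩ := hz
  obtain ⟨j, hw⟩ := hw
  exact ⟨_, hz.mul hw⟩

lemma G.conj {z : ℂ} (hz : g.G z) : g.G (starRingEnd ℂ z) := by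
  obtain ⟨i, hz⟩ := hz
  exact ⟨_, hz.conj⟩

lemma G.neg {z : ℂ} (hz : g.G z) : g.G (-z) := by
  obtain ⟨i, hz⟩ := hz
  exact ⟨_, hz.neg⟩

lemma G.zmul {z : ℂ} (n : ℤ) (hz : g.G z) : g.G (n * z) := by
  obtain ⟨i, hz⟩ := hz
  exact ⟨_, hz.zmul n⟩

lemma Gp.one : g.Gp false 1 := ⟨1, 0, by simp [GD.el]⟩
lemma G.one : g.G 1 := ⟨_, Gp.one⟩

lemma sq_eq {a b : ℤ} (h : a ^ 2 = g.A * b ^ 2) : a = 0 ∧ b = 0 := by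
  by_cases hb : b = 0
  · subst hb
    simp at h
    exact ⟨h, rfl⟩
  · exfalso
    have h1 : b ^ 2 ∣ a ^ 2 := ⟨g.A, by rw [h]; ring⟩
    rw [Int.pow_dvd_pow_iff two_ne_zero] at h1
    obtain ⟨c, rfl⟩ := h1
    have h2 : g.A = c * c := by
      have : b ^ 2 ≠ 0 := pow_ne_zero _ hb
      apply mul_right_cancel₀ this
      linarith
    exact g.hA.irreducible.not_isSquare ⟨c, h2⟩

lemma nm4 (i : Bool) (x y : ℤ) : 4 * g.nm i x y =
    if i then g.A * (2 * x + g.δ * y) ^ 2 + (4 * g.C - g.A * g.δ ^ 2) * y ^ 2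
    else (2 * x + g.A * g.δ * y) ^ 2 + g.A * (4 * g.C - g.A * g.δ ^ 2) * y ^ 2 := by
  cases i <;> simp [nm] <;> ring

lemma nm_nonneg (i : Bool) (x y : ℤ) : 0 ≤ g.nm i x y := by
  have h := g.nm4 i x y
  have h1 := g.hA0
  have h2 := g.hQ
  have h3 : 0 ≤ 4 * g.C - g.A * g.δ ^ 2 := by linarith
  cases i
  · simp only [Bool.false_eq_true, if_false] at h
    have : 0 ≤ (2 * x + g.A * g.δ * y) ^ 2 + g.A * (4 * g.C - g.A * g.δ ^ 2) * y ^ 2 := by positivity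
    linarith
  · simp only [if_true] at h
    have : 0 ≤ g.A * (2 * x + g.δ * y) ^ 2 + (4 * g.C - g.A * g.δ ^ 2) * y ^ 2 := by positivity
    linarith

lemma G.norm {z : ℂ} (hz : g.G z) : ∃ n : ℕ, z * starRingEnd ℂ z = n := by
  obtain ⟨i, x, y, rfl⟩ := hz
  refine ⟨(g.nm i x y).toNat, ?_⟩
  rw [el_norm]
  have := Int.toNat_of_nonneg (g.nm_nonneg i x y)
  exact_mod_cast this.symm

lemma disj {z : ℂ} (h0 : g.Gp false z) (h1 : g.Gp true z) : z = 0 := by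
  have hr := g.hr
  obtain ⟨x, y, rfl⟩ := h0
  obtain ⟨u, v, h⟩ := h1
  have h' : starRingEnd ℂ (g.el false x y) = starRingEnd ℂ (g.el true u v) := by rw [h]
  have hn : g.nm false x y = g.nm true u v := by
    have := g.el_norm false x y
    rw [h, el_norm] at this
    exact_mod_cast this.symm
  have ht : ((2 * x + g.A * g.δ * y : ℤ) : ℂ) = g.r * ((2 * u + g.δ * v : ℤ) : ℂ) := by
    simp [el, g.hrc, g.cjt] at h h'
    push_cast
    linear_combination h + h' - (y * g.δ) * hr
  have ht2 : (2 * x + g.A * g.δ * y) ^ 2 = g.A * (2 * u + g.δ * v) ^ 2 := by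
    have : ((2 * x + g.A * g.δ * y : ℤ) : ℂ) ^ 2 = g.A * ((2 * u + g.δ * v : ℤ) : ℂ) ^ 2 := by
      rw [ht, mul_pow, sq g.r, hr]
    exact_mod_cast this
  obtain ⟨e1, e2⟩ := sq_eq ht2
  have n1 := g.nm4 false x y
  have n2 := g.nm4 true u v
  simp only [Bool.false_eq_true, if_false, if_true, e1, e2] at n1 n2
  have hQ := g.hQ
  have e3 : v ^ 2 = g.A * y ^ 2 := by
    have : (4 * g.C - g.A * g.δ ^ 2) ≠ 0 := by linarith
    apply mul_left_cancel₀ this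
    linarith
  obtain ⟨rfl, rfl⟩ := sq_eq e3
  have : x = 0 := by simpa using e1
  subst this
  simp [el]

lemma Gp.of_mul {i : Bool} {z : ℂ} {n : ℤ} (hn : n ≠ 0) (h : g.Gp i (n * z)) (hz : g.G z) :
    g.Gp i z := by
  obtain ⟨j, hz⟩ := hz
  have hn' : (n : ℂ) ≠ 0 := by exact_mod_cast hn
  by_cases hij : i = j
  · rwa [hij]
  · have h0 : (n : ℂ) * z = 0 := by
      have h2 := hz.zmul n
      cases i <;> cases j
      · exact absurd rfl hij
      · exact disj h h2
      · exact disj h2 h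
      · exact absurd rfl hij
    have : z = 0 := by simpa [hn'] using h0
    subst this
    exact ⟨0, 0, by cases i <;> simp [GD.el]⟩

/-- Bezout cancellation. -/
lemma G.bez {z : ℂ} {m n : ℤ} (hm : m ≠ 0) (hc : IsCoprime n m) (hz : g.G (m * z))
    (hn : g.G (n * z)) : g.G z := by
  obtain ⟨i, hz⟩ := hz
  have h2 : g.Gp i (n * z) := by
    apply Gp.of_mul hm _ hn
    have := hz.zmul n
    convert this using 1
    ring
  obtain ⟨a, b, hab⟩ := hc
  refine ⟨i, ?_⟩
  have := (h2.zmul a).add (hz.zmul b)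
  convert this using 1
  have hab' : (a : ℂ) * n + b * m = 1 := by exact_mod_cast hab
  linear_combination (-z) * hab'

lemma nm_one {z : ℂ} (hz : g.G z) (h : z * starRingEnd ℂ z = 1) : z = 1 ∨ z = -1 := by
  obtain ⟨i, x, y, rfl⟩ := hz
  rw [el_norm] at h
  have h : g.nm i x y = 1 := by exact_mod_cast h
  have h4 := g.nm4 i x y
  rw [h] at h4
  have h1 := g.hA0
  have hA2 : 2 ≤ g.A := by
    by_contra hh
    have : g.A = 1 := by omega
    exact g.hA.not_isUnit (by rw [this]; exact isUnit_one)
  have h2 := g.hQ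
  have h3 := g.hQ4
  generalize hq : 4 * g.C - g.A * g.δ ^ 2 = q at h2 h3 h4
  cases i
  · simp only [Bool.false_eq_true, if_false] at h4
    have hy : y = 0 := by
      by_contra hy
      have : 1 ≤ y ^ 2 := by have := sq_pos_of_ne_zero hy; omega
      nlinarith [mul_le_mul hA2 h2 (by norm_num) (by linarith), sq_nonneg (2 * x + g.A * g.δ * y)]
    subst hy
    have : x ^ 2 = 1 := by nlinarith
    have hx : (x - 1) * (x + 1) = 0 := by linarith
    rcases mul_eq_zero.mp hx with hx | hx
    · left
      have : x = 1 := by omega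
      subst this
      simp [el]
    · right
      have : x = -1 := by omega
      subst this
      simp [el]
  · exfalso
    simp only [if_true] at h4
    by_cases hy : y = 0
    · subst hy
      have h5 : g.A * x ^ 2 = 1 := by nlinarith
      exact g.hA.not_isUnit (IsUnit.of_mul_eq_one _ h5)
    · have h6 : 1 ≤ y ^ 2 := by have := sq_pos_of_ne_zero hy; omega
      have h7 : 0 ≤ g.A * (2 * x + g.δ * y) ^ 2 := by positivity
      have hq3 : q = 3 := by
        have : q ≤ 4 := by nlinarith
        omega
      rw [hq3] at h4
      have h8 : y ^ 2 = 1 := by omega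
      have h5 : g.A * (2 * x + g.δ * y) ^ 2 = 1 := by linarith
      exact g.hA.not_isUnit (IsUnit.of_mul_eq_one _ h5)

end GD

namespace GD
variable {g : GD}

lemma Gp.normZ {i : Bool} {z : ℂ} (hz : g.Gp i z) : ∃ n : ℤ, z * starRingEnd ℂ z = n := by
  obtain ⟨x, y, rfl⟩ := hz
  exact ⟨_, el_norm _ _ _ _⟩

lemma dvd_x {p x y : ℤ} (hp : Prime p) (h : p ∣ g.nm false x y) (hy : p ∣ y) : p ∣ x := by
  have h1 : x ^ 2 = g.nm false x y - y * (g.A * g.δ * x + g.A * g.C * y) := by simp [nm]; ring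
  apply hp.dvd_of_dvd_pow (n := 2)
  rw [h1]
  exact dvd_sub h (hy.mul_right _)

lemma dvd_sq {p x y : ℤ} (hx : p ∣ x) (hy : p ∣ y) : p * p ∣ g.nm false x y := by
  obtain ⟨a, rfl⟩ := hx
  obtain ⟨b, rfl⟩ := hy
  exact ⟨g.nm false a b, by simp [nm]; ring⟩

lemma exists_s {p : ℤ} (hp : Prime p) (i : Bool) :
    ∃ s, ∃ n : ℤ, g.Gp i s ∧ s * starRingEnd ℂ s = n ∧ ¬ p ∣ n := by
  cases i
  · exact ⟨1, 1, Gp.one, by simp, fun h => hp.not_isUnit (isUnit_of_dvd_one h)⟩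
  · by_cases h : p ∣ g.A
    · refine ⟨_, _, Gp.el true 0 1, el_norm _ _ _ _, ?_⟩
      simp [nm]
      intro h2
      have := (hp.associated_of_dvd g.hA h).symm.dvd
      exact g.hAC (this.trans h2)
    · refine ⟨_, _, Gp.el true 1 0, el_norm _ _ _ _, ?_⟩
      simpa [nm] using h

lemma cop {p n : ℤ} (hp : Prime p) (h : ¬ p ∣ n) : IsCoprime n p :=
  ((Prime.coprime_iff_not_dvd hp).mpr h).symm

lemma inv_mod {p y : ℤ} (hp : Prime p) (hy : ¬ p ∣ y) : ∃ a l : ℤ, y * a = 1 + p * l := by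
  obtain ⟨a, b, hab⟩ := cop hp hy
  exact ⟨a, -b, by linarith⟩

lemma root_of {p : ℤ} (hp : Prime p) {i : Bool} {π : ℂ} (hπ : g.Gp i π)
    (hN : π * starRingEnd ℂ π = p) :
    ∃ k : ℤ, ∃ h, g.Gp i h ∧ g.el false k 1 * starRingEnd ℂ π = p * h ∧ p ∣ g.nm false k 1 := by
  obtain ⟨s, n, hs, hsn, hpn⟩ := g.exists_s hp i
  have hm := hπ.mul hs
  simp only [Bool.xor_self] at hm
  obtain ⟨x, y, hxy⟩ := hm
  have hnm : g.nm false x y = p * n := by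
    have := g.el_norm false x y
    rw [← hxy] at this
    have h2 : (p * n : ℂ) = g.nm false x y := by
      rw [← this, ← hN, ← hsn]; simp only [map_mul]; ring
    exact_mod_cast h2.symm
  have hy : ¬ p ∣ y := by
    intro hy
    have hx := dvd_x hp (hnm ▸ Dvd.intro _ rfl) hy
    have := g.dvd_sq hx hy
    rw [hnm] at this
    exact hpn ((mul_dvd_mul_iff_left hp.ne_zero).mp this)
  obtain ⟨a, l, hal⟩ := inv_mod hp hy
  have hal' : (y * a : ℂ) = 1 + p * l := by exact_mod_cast hal
  have hω : g.Gp false (g.r * g.τ) := ⟨0, 1, by simp [el]⟩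
  have hc := (hω.mul hπ.conj).zmul l
  simp only [Bool.false_xor] at hc
  refine ⟨x * a, a * s - l * (g.r * g.τ * starRingEnd ℂ π), (hs.zmul a).sub hc, ?_, ?_⟩
  · simp only [el, Bool.false_eq_true, if_false] at hxy ⊢
    push_cast
    linear_combination (-a * starRingEnd ℂ π) * hxy + a * s * hN  - (g.r * g.τ) * starRingEnd ℂ π * hal'
  · have : g.nm false (x * a) 1 = a ^ 2 * g.nm false x y
        + (1 - y * a) * (g.A * g.δ * (x * a) + g.A * g.C * (1 + y * a)) := by
      simp [nm]; ring
    rw [this, hnm, hal]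
    exact ⟨a ^ 2 * n - l * (g.A * g.δ * (x * a) + g.A * g.C * (1 + (1 + p * l))), by ring⟩

lemma PR0 {p : ℤ} (hp : Prime p) {π : ℂ} (hπ : g.G π)
    (hN : π * starRingEnd ℂ π = p) {x y : ℤ} (hz : p ∣ g.nm false x y) :
    g.G (g.el false x y * starRingEnd ℂ π / p) ∨ g.G (g.el false x y * π / p) := by
  have hp0 : (p : ℂ) ≠ 0 := by exact_mod_cast hp.ne_zero
  obtain ⟨i, hπ⟩ := hπ
  obtain ⟨k, h, hh, hk, hkn⟩ := root_of hp hπ hN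
  have key : ∀ x y : ℤ, p ∣ x - y * k → g.Gp i (g.el false x y * starRingEnd ℂ π / p) := by
    intro x y ⟨c, hc⟩
    have := (hπ.conj.zmul c).add (hh.zmul y)
    convert this using 1
    field_simp
    have hc' : (x : ℂ) - y * k = p * c := by exact_mod_cast hc
    simp only [el, Bool.false_eq_true, if_false] at hk ⊢
    push_cast at hk
    linear_combination y * hk + starRingEnd ℂ π * hc'
  have hprod : p ∣ (x - y * k) * (x + g.A * g.δ * y - (-y) * k) := by
    have : (x - y * k) * (x + g.A * g.δ * y - (-y) * k)
      = g.nm false x y - y ^ 2 * g.nm false k 1 := by simp [nm]; ring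
    rw [this]
    exact dvd_sub hz (hkn.mul_left _)
  rcases hp.dvd_or_dvd hprod with h1 | h1
  · exact Or.inl ⟨i, key _ _ h1⟩
  · right
    have := (key _ _ h1).conj
    refine ⟨i, ?_⟩
    convert this using 1
    simp only [map_div₀, map_mul, map_intCast, Complex.conj_conj]
    congr 2
    simp [el, g.hrc, g.cjt]
    linear_combination (y * g.δ) * g.hr

lemma PR {p : ℤ} (hp : Prime p) {π : ℂ} (hπ : g.G π)
    (hN : π * starRingEnd ℂ π = p) {z : ℂ} (hz : g.G z) {m : ℤ}
    (hm : z * starRingEnd ℂ z = m) (hpm : p ∣ m) :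
    g.G (z * starRingEnd ℂ π / p) ∨ g.G (z * π / p) := by
  have hp0 : (p : ℂ) ≠ 0 := by exact_mod_cast hp.ne_zero
  obtain ⟨i, hzi⟩ := id hz
  obtain ⟨s, n, hs, hsn, hpn⟩ := g.exists_s hp i
  have hmm := hzi.mul hs
  simp only [Bool.xor_self] at hmm
  obtain ⟨x, y, hxy⟩ := hmm
  have hnm : g.nm false x y = m * n := by
    have := g.el_norm false x y
    rw [← hxy] at this
    have h2 : (m * n : ℂ) = g.nm false x y := by
      rw [← this, ← hm, ← hsn]; simp only [map_mul]; ring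
    exact_mod_cast h2.symm
  have hsG : g.G (starRingEnd ℂ s) := ⟨_, hs.conj⟩
  rcases PR0 hp hπ hN (x := x) (y := y) (by rw [hnm]; exact hpm.mul_right _) with h | h
  · left
    apply G.bez hp.ne_zero (cop hp hpn)
    · convert hz.mul hπ.conj using 1
      field_simp
    · convert h.mul hsG using 1
      rw [← hxy]
      linear_combination (-z * starRingEnd ℂ π / p) * hsn
  · right
    apply G.bez hp.ne_zero (cop hp hpn)
    · convert hz.mul hπ using 1
      field_simp
    · convert h.mul hsG using 1
      rw [← hxy]
      linear_combination (-z * π / p) * hsn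

lemma exists_pi {p k : ℤ} (hp : Prime p) (hp0 : 0 < p) (hk : p ∣ g.nm false k 1) :
    ∃ π, g.G π ∧ π * starRingEnd ℂ π = p := by
  obtain ⟨c, hc⟩ := hk
  have hc' : k ^ 2 + g.A * g.δ * k + g.A * g.C = p * c := by
    rw [← hc]; simp [nm]
  obtain ⟨X, Y, h⟩ := g.hCP p (2 * k + g.A * g.δ) c hp0 (by linear_combination 4 * hc')
  have hη : g.nm false (p * X + k * Y) Y
      = p * (p * X ^ 2 + (2 * k + g.A * g.δ) * X * Y + c * Y ^ 2) := by
    simp [nm]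
    linear_combination Y ^ 2 * hc'
  rcases h with h | h
  · refine ⟨_, ⟨_, Gp.el false (p * X + k * Y) Y⟩, ?_⟩
    rw [el_norm, hη, h, mul_one]
  · rw [h] at hη
    generalize p * X + k * Y = u at hη
    simp [nm] at hη
    have hu : g.A ∣ u := by
      apply g.hA.dvd_of_dvd_pow (n := 2)
      exact ⟨p - g.δ * u * Y - g.C * Y ^ 2, by linarith⟩
    obtain ⟨v, rfl⟩ := hu
    refine ⟨_, ⟨_, Gp.el true v Y⟩, ?_⟩
    rw [el_norm]
    congr 1
    apply mul_left_cancel₀ g.hA.ne_zero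
    simp only [nm, if_true]
    linear_combination hη

lemma KL {p : ℤ} (hp : Prime p) (hp0 : 0 < p) {z : ℂ} (hz : g.G z) {m : ℤ}
    (hm : z * starRingEnd ℂ z = m) (hpm : p ∣ m) :
    g.G (z / p) ∨ ∃ π, g.G π ∧ π * starRingEnd ℂ π = p ∧ g.G (z * starRingEnd ℂ π / p) := by
  by_cases hzp : g.G (z / p)
  · exact Or.inl hzp
  right
  have hpc : (p : ℂ) ≠ 0 := by exact_mod_cast hp.ne_zero
  suffices h : ∃ k, p ∣ g.nm false k 1 by
    obtain ⟨k, hk⟩ := h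
    obtain ⟨π, h1, h2⟩ := exists_pi hp hp0 hk
    rcases PR hp h1 h2 hz hm hpm with h3 | h3
    · exact ⟨π, h1, h2, h3⟩
    · refine ⟨_, h1.conj, ?_, by simpa using h3⟩
      rw [Complex.conj_conj, mul_comm, h2]
  obtain ⟨i, hzi⟩ := id hz
  obtain ⟨s, n, hs, hsn, hpn⟩ := g.exists_s hp i
  have hmm := hzi.mul hs
  simp only [Bool.xor_self] at hmm
  obtain ⟨x, y, hxy⟩ := hmm
  have hnm : g.nm false x y = m * n := by
    have := g.el_norm false x y
    rw [← hxy] at this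
    have h2 : (m * n : ℂ) = g.nm false x y := by
      rw [← this, ← hm, ← hsn]; simp only [map_mul]; ring
    exact_mod_cast h2.symm
  have hsG : g.G (starRingEnd ℂ s) := ⟨_, hs.conj⟩
  have hd : p ∣ g.nm false x y := by rw [hnm]; exact hpm.mul_right _
  have hy : ¬ p ∣ y := by
    intro hy
    obtain ⟨a, rfl⟩ := dvd_x hp hd hy
    obtain ⟨b, rfl⟩ := hy
    apply hzp
    apply G.bez hp.ne_zero (cop hp hpn)
    · convert hz using 1
      field_simp
    · have h3 : g.G (g.el false a b) := ⟨_, Gp.el _ _ _⟩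
      convert h3.mul hsG using 1
      have : g.el false (p * a) (p * b) = p * g.el false a b := by simp [el]; ring
      rw [this] at hxy
      field_simp
      linear_combination (-z) * hsn + starRingEnd ℂ s * hxy
  obtain ⟨a, l, hal⟩ := inv_mod hp hy
  refine ⟨x * a, ?_⟩
  have : g.nm false (x * a) 1 = a ^ 2 * g.nm false x y
        + (1 - y * a) * (g.A * g.δ * (x * a) + g.A * g.C * (1 + y * a)) := by
      simp [nm]; ring
  rw [this, hal]
  exact dvd_add (hd.mul_left _) ⟨-l * (g.A * g.δ * (x * a) + g.A * g.C * (1 + (1 + p * l))), by ring⟩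

end GD

namespace GD
variable {g : GD}

lemma A_two (g : GD) : 2 ≤ g.A := by
  have h1 := g.hA0
  by_contra hh
  have : g.A = 1 := by omega
  exact g.hA.not_isUnit (by rw [this]; exact isUnit_one)

lemma C_pos (g : GD) : 0 < g.C := by
  have h1 := g.hA0
  have h2 := g.hQ
  have : 0 ≤ g.A * g.δ ^ 2 := by positivity
  linarith

lemma nm_y (i : Bool) (x y : ℤ) : y ^ 2 ≤ 4 * g.nm i x y := by
  have h := g.nm4 i x y
  have h1 := g.A_two
  have h2 := g.hQ
  have hq := g.hQ
  rw [h]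
  generalize 4 * g.C - g.A * g.δ ^ 2 = q at *
  cases i
  · simp only [Bool.false_eq_true, if_false]
    nlinarith [sq_nonneg (2 * x + g.A * g.δ * y), mul_le_mul h1 h2 (by norm_num) (by linarith), sq_nonneg y]
  · simp only [if_true]
    nlinarith [mul_nonneg (by linarith : 0 ≤ g.A) (sq_nonneg (2 * x + g.δ * y)), sq_nonneg y]

lemma nm_x (i : Bool) (x y : ℤ) : x ^ 2 ≤ 4 * g.A * g.C * g.nm i x y := by
  have h1 := g.A_two
  have h2 := g.hQ
  have h3 := g.C_pos
  have hE : 6 ≤ g.A * (4 * g.C - g.A * g.δ ^ 2) :=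
    mul_le_mul h1 h2 (by norm_num) (by linarith)
  cases i
  · have : 4 * g.A * g.C * g.nm false x y = (2 * g.A * g.C * y + g.A * g.δ * x) ^ 2 +
      g.A * (4 * g.C - g.A * g.δ ^ 2) * x ^ 2 := by simp [nm]; ring
    nlinarith [sq_nonneg (2 * g.A * g.C * y + g.A * g.δ * x), sq_nonneg x]
  · have : 4 * g.A * g.C * g.nm true x y = g.A * ((2 * g.C * y + g.A * g.δ * x) ^ 2 +
      g.A * (4 * g.C - g.A * g.δ ^ 2) * x ^ 2) := by simp [nm]; ring
    nlinarith [sq_nonneg (2 * g.C * y + g.A * g.δ * x), sq_nonneg x,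
      mul_le_mul h1 hE (by norm_num) (by linarith),
      mul_nonneg (by linarith : 0 ≤ g.A) (sq_nonneg (2 * g.C * y + g.A * g.δ * x))]

variable (g) in
def S (m : ℕ) : Set ℂ := {z | g.G z ∧ z * starRingEnd ℂ z = m}

lemma nm_fin (i : Bool) (m : ℕ) : {p : ℤ × ℤ | g.nm i p.1 p.2 = m}.Finite := by
  apply Set.Finite.subset (Set.finite_Icc ((-(4 * g.A * g.C * m), -(4 * m)) : ℤ × ℤ)
    ((4 * g.A * g.C * m), (4 * m)))
  rintro ⟨x, y⟩ h
  simp only [Set.mem_ofPred_eq] at h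
  have hx := g.nm_x i x y
  have hy := g.nm_y i x y
  rw [h] at hx hy
  have aux : ∀ x M : ℤ, x ^ 2 ≤ M → -M ≤ x ∧ x ≤ M := by
    intro x M h
    constructor <;> nlinarith [sq_nonneg (x - 1), sq_nonneg (x + 1), Int.le_self_sq x, Int.le_self_sq (-x)]
  have := aux _ _ hx
  have := aux _ _ hy
  simp only [Set.mem_Icc, Prod.le_def]
  tauto

lemma S_eq (m : ℕ) : g.S m = (fun p : ℤ × ℤ => g.el false p.1 p.2) '' {p | g.nm false p.1 p.2 = m}
    ∪ (fun p : ℤ × ℤ => g.el true p.1 p.2) '' {p | g.nm true p.1 p.2 = m} := by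
  ext z
  constructor
  · rintro ⟨⟨i, x, y, rfl⟩, h⟩
    rw [el_norm] at h
    have h : g.nm i x y = m := by exact_mod_cast h
    cases i
    · exact Or.inl ⟨(x, y), h, rfl⟩
    · exact Or.inr ⟨(x, y), h, rfl⟩
  · rintro (⟨⟨x, y⟩, h, rfl⟩ | ⟨⟨x, y⟩, h, rfl⟩)
    · refine ⟨⟨_, Gp.el _ _ _⟩, ?_⟩
      simp only [Set.mem_ofPred_eq] at h
      rw [el_norm, h]; simp
    · refine ⟨⟨_, Gp.el _ _ _⟩, ?_⟩
      simp only [Set.mem_ofPred_eq] at h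
      rw [el_norm, h]; simp

lemma S_fin (m : ℕ) : (g.S m).Finite := by
  rw [S_eq]
  exact ((nm_fin _ _).image _).union ((nm_fin _ _).image _)

variable (g) in
noncomputable def SF (m : ℕ) : Finset ℂ := (g.S_fin m).toFinset

lemma mem_SF {m : ℕ} {z : ℂ} : z ∈ g.SF m ↔ g.G z ∧ z * starRingEnd ℂ z = m := by
  simp [SF, S]

variable (g) in
noncomputable def T (m : ℕ) : ℂ := ∑ z ∈ g.SF m, z ^ 2

open Classical in
variable (g) in
noncomputable def F (m : ℕ) (t : ℂ) : Finset ℂ :=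
  (g.SF m).filter (fun z => g.G (t * starRingEnd ℂ z / m))

lemma mem_F {m : ℕ} {t z : ℂ} : z ∈ g.F m t ↔
    (g.G z ∧ z * starRingEnd ℂ z = m) ∧ g.G (t * starRingEnd ℂ z / m) := by
  simp [F, mem_SF]

lemma conv (m n : ℕ) (hm : 0 < m) :
    g.T m * g.T n = ∑ t ∈ g.SF (m * n), ((g.F m t).card : ℂ) * t ^ 2 := by
  classical
  have hm' : (m : ℂ) ≠ 0 := by exact_mod_cast hm.ne'
  unfold T
  rw [Finset.sum_mul_sum, ← Finset.sum_product']
  rw [← Finset.sum_fiberwise_of_maps_to (s := g.SF m ×ˢ g.SF n) (t := g.SF (m * n))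
    (g := fun q => q.1 * q.2)]
  · apply Finset.sum_congr rfl
    intro t ht
    rw [mem_SF] at ht
    rw [Finset.sum_congr rfl (g := fun _ => t ^ 2)]
    · rw [Finset.sum_const, nsmul_eq_mul]
      congr 2
      apply Finset.card_bij' (fun q _ => q.1) (fun z _ => (z, t * starRingEnd ℂ z / m))
      · rintro ⟨z, w⟩ h
        simp only [Finset.mem_filter, Finset.mem_product, mem_SF] at h
        obtain ⟨⟨⟨h1, h2⟩, h3, h4⟩, h5⟩ := h
        rw [mem_F]
        refine ⟨⟨h1, h2⟩, ?_⟩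
        convert h3 using 1
        field_simp
        rw [← h5, ← h2]; ring
      · intro z h
        rw [mem_F] at h
        obtain ⟨⟨h1, h2⟩, h3⟩ := h
        simp only [Finset.mem_filter, Finset.mem_product, mem_SF]
        refine ⟨⟨⟨h1, h2⟩, h3, ?_⟩, ?_⟩
        · simp only [map_div₀, map_mul, map_natCast, Complex.conj_conj]
          field_simp
          have := ht.2
          push_cast at this
          linear_combination z * starRingEnd ℂ z * this + m * n * h2
        · field_simp
          linear_combination t * h2
      · rintro ⟨z, w⟩ h
        simp only [Finset.mem_filter, Finset.mem_product, mem_SF] at h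
        obtain ⟨⟨⟨h1, h2⟩, h3, h4⟩, h5⟩ := h
        ext1
        · rfl
        · simp only
          field_simp
          rw [← h5, ← h2]; ring
      · intro z h
        rfl
    · rintro ⟨z, w⟩ h
      simp only [Finset.mem_filter] at h
      rw [← h.2]; ring
  · rintro ⟨z, w⟩ h
    simp only [Finset.mem_product, mem_SF] at h ⊢
    obtain ⟨⟨h1, h2⟩, h3, h4⟩ := h
    refine ⟨h1.mul h3, ?_⟩
    push_cast
    rw [← h2, ← h4, map_mul]; ring

lemma ex_div (m : ℕ) : ∀ n : ℕ, 0 < m → Nat.Coprime m n → ∀ t, g.G t →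
    t * starRingEnd ℂ t = (m * n : ℕ) →
    ∃ z, (g.G z ∧ z * starRingEnd ℂ z = m) ∧ g.G (t * starRingEnd ℂ z / m) := by
  induction m using Nat.strong_induction_on with
  | _ m ih =>
  intro n hm hc t ht htn
  by_cases h1 : m = 1
  · subst h1
    exact ⟨1, ⟨G.one, by simp⟩, by simpa using ht⟩
  have hp := Nat.minFac_prime h1
  obtain ⟨m', hm'⟩ := Nat.minFac_dvd m
  set p := m.minFac with hpdef
  have hpc : (p : ℂ) ≠ 0 := by exact_mod_cast hp.ne_zero
  have hpn : Nat.Coprime p n := Nat.Coprime.coprime_dvd_left (hm' ▸ Dvd.intro _ rfl) hc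
  have hcj : (starRingEnd ℂ) (p : ℂ) = p := map_natCast _ _
  have hm'0 : 0 < m' := by
    rcases Nat.eq_zero_or_pos m' with h | h
    · subst h; omega
    · exact h
  have hp2 := hp.two_le
  rcases KL (p := p) (Nat.prime_iff_prime_int.mp hp) (by exact_mod_cast hp.pos) ht
      (m := (m * n : ℕ)) (by rw [htn]; simp)
      (by rw [hm', mul_assoc]; push_cast; exact Dvd.intro _ rfl) with h | ⟨π, h3, h4, h5⟩
  · push_cast at h
    obtain ⟨k, hk⟩ := h.norm
    rw [map_div₀, hcj] at hk
    field_simp at hk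
    rw [htn] at hk
    have hk' : m * n = k * p ^ 2 := by
      have : ((m * n : ℕ) : ℂ) = ((k * p ^ 2 : ℕ) : ℂ) := by rw [hk]; push_cast; ring
      exact_mod_cast this
    have hpm' : p ∣ m' := by
      have h6 : m' * n = k * p := by
        apply Nat.eq_of_mul_eq_mul_left hp.pos
        rw [← mul_assoc, ← hm', hk']; ring
      exact hpn.dvd_of_dvd_mul_right (h6 ▸ Dvd.intro_left _ rfl)
    obtain ⟨q, rfl⟩ := hpm'
    have hq0 : 0 < q := Nat.pos_of_mul_pos_left hm'0
    obtain ⟨z, ⟨hz1, hz2⟩, hz3⟩ := ih q (by rw [hm']; nlinarith) n hq0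
      (Nat.Coprime.coprime_dvd_left ⟨p * p, by rw [hm']; ring⟩ hc) _ h (by
        rw [map_div₀, hcj]
        field_simp
        rw [htn, hm']; push_cast; ring)
    have hqc : (q : ℂ) ≠ 0 := by exact_mod_cast hq0.ne'
    refine ⟨p * z, ⟨by simpa using hz1.zmul p, ?_⟩, ?_⟩
    · rw [hm', map_mul, hcj]; push_cast
      linear_combination p * p * hz2
    · convert hz3 using 1
      rw [hm', map_mul, hcj]; push_cast
      field_simp
  · push_cast at h4 h5
    obtain ⟨z, ⟨hz1, hz2⟩, hz3⟩ := ih m' (by rw [hm']; nlinarith) n hm'0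
      (Nat.Coprime.coprime_dvd_left ⟨p, by rw [hm']; ring⟩ hc) _ h5 (by
        rw [map_div₀, map_mul, Complex.conj_conj, hcj]
        field_simp
        have e : ((m * n : ℕ) : ℂ) = p * m' * n := by rw [hm']; push_cast; ring
        rw [e] at htn
        push_cast
        linear_combination π * starRingEnd ℂ π * htn + p * m' * n * h4)
    have hqc : (m' : ℂ) ≠ 0 := by exact_mod_cast hm'0.ne'
    refine ⟨π * z, ⟨h3.mul hz1, ?_⟩, ?_⟩
    · rw [hm', map_mul]; push_cast
      linear_combination z * starRingEnd ℂ z * h4 + p * hz2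
    · convert hz3 using 1
      rw [hm', map_mul]; push_cast
      field_simp

lemma ne_neg {m : ℕ} (hm : 0 < m) {z : ℂ} (h : z * starRingEnd ℂ z = m) : z ≠ 0 ∧ z ≠ -z := by
  have : z ≠ 0 := by
    rintro rfl
    rw [zero_mul] at h
    exact hm.ne' (by exact_mod_cast h.symm)
  exact ⟨this, fun h => this (self_eq_neg.mp h)⟩

/-- two elements of equal norm whose quotient lies in `G` agree up to sign -/
lemma assoc {m : ℕ} (hm : 0 < m) {z w : ℂ} (hz : z * starRingEnd ℂ z = m)
    (hw : w * starRingEnd ℂ w = m) (h : g.G (z * starRingEnd ℂ w / m)) : z = w ∨ z = -w := by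
  have hm' : (m : ℂ) ≠ 0 := by exact_mod_cast hm.ne'
  have hw0 : starRingEnd ℂ w ≠ 0 := by
    simpa using (ne_neg hm hw).1
  have h1 := nm_one h (by
    rw [map_div₀, map_mul, Complex.conj_conj, map_natCast]
    field_simp
    linear_combination w * starRingEnd ℂ w * hz + m * hw)
  rcases h1 with h1 | h1
  · left
    field_simp at h1
    apply mul_right_cancel₀ hw0
    rw [h1, hw]
  · right
    field_simp at h1
    apply mul_right_cancel₀ hw0
    rw [h1, neg_mul, hw]

lemma card_F_coprime {m n : ℕ} (hm : 0 < m) (hc : Nat.Coprime m n) {t : ℂ}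
    (ht : t ∈ g.SF (m * n)) : (g.F m t).card = 2 := by
  classical
  rw [mem_SF] at ht
  have hm' : (m : ℂ) ≠ 0 := by exact_mod_cast hm.ne'
  obtain ⟨z, hz1, hz2⟩ := ex_div m n hm hc t ht.1 ht.2
  have : g.F m t = {z, -z} := by
    ext w
    rw [mem_F]
    simp only [Finset.mem_insert, Finset.mem_singleton]
    constructor
    · rintro ⟨⟨h1, h2⟩, h3⟩
      apply assoc hm h2 hz1.2 (g := g)
      apply G.bez (m := m) (n := n) (by exact_mod_cast hm.ne')
        (by exact_mod_cast (Nat.isCoprime_iff_coprime.mpr hc).symm)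
      · convert h1.mul hz1.1.conj using 1
        push_cast; field_simp
      · convert hz2.mul h3.conj using 1
        rw [map_div₀, map_mul, Complex.conj_conj, map_natCast]
        have := ht.2
        push_cast at this ⊢
        field_simp
        linear_combination (-w * starRingEnd ℂ z) * this
    · rintro (rfl | rfl)
      · exact ⟨hz1, hz2⟩
      · refine ⟨⟨hz1.1.neg, by simpa using hz1.2⟩, ?_⟩
        convert hz2.neg using 1
        simp; ring
  rw [this, Finset.card_pair (ne_neg hm hz1.2).2]

lemma T_mul {m n : ℕ} (hm : 0 < m) (hc : Nat.Coprime m n) :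
    g.T m * g.T n = 2 * g.T (m * n) := by
  rw [conv m n hm, T, Finset.mul_sum]
  apply Finset.sum_congr rfl
  intro t ht
  rw [card_F_coprime hm hc ht]
  norm_num

lemma T_one : g.T 1 = 2 := by
  classical
  have : g.SF 1 = {1, -1} := by
    ext z
    rw [mem_SF]
    simp only [Finset.mem_insert, Finset.mem_singleton]
    constructor
    · rintro ⟨h1, h2⟩
      exact nm_one h1 (by simpa using h2)
    · rintro (rfl | rfl)
      · exact ⟨G.one, by simp⟩
      · exact ⟨G.one.neg, by simp⟩
  rw [T, this, Finset.sum_pair (by norm_num)]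
  norm_num

end GD

namespace GD
variable {g : GD}

lemma no_sol {p q y : ℤ} (hp : Prime p) (hq : 3 ≤ q) (hpq : ¬ p ∣ q)
    (hp2 : 2 ≤ p) (h : q * y ^ 2 = 4 * p) : False := by
  have h1 : p ∣ y := by
    have : p ∣ q * y ^ 2 := ⟨4, by rw [h]; ring⟩
    exact hp.dvd_of_dvd_pow ((hp.dvd_or_dvd this).resolve_left hpq)
  obtain ⟨z, rfl⟩ := h1
  have h2 : q * p * z ^ 2 = 4 := by
    apply mul_left_cancel₀ hp.ne_zero
    linarith
  have hz : z ≠ 0 := by rintro rfl; simp at h2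
  have : 1 ≤ z ^ 2 := by have := sq_pos_of_ne_zero hz; omega
  nlinarith [mul_le_mul hq hp2 (by norm_num) (by linarith)]

lemma E_six (g : GD) : 6 ≤ g.A * (4 * g.C - g.A * g.δ ^ 2) :=
  mul_le_mul g.A_two g.hQ (by norm_num) (by linarith [g.A_two])

lemma not_ram {p : ℤ} (hp : Prime p) (hp2 : 2 ≤ p)
    (hE : ¬ p ∣ g.A * (4 * g.C - g.A * g.δ ^ 2)) {π : ℂ} (hπ : g.G π)
    (hN : π * starRingEnd ℂ π = p) : π ≠ starRingEnd ℂ π ∧ π ≠ -starRingEnd ℂ π := by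
  have hE6 := g.E_six
  have hr := g.hr
  obtain ⟨i, x, y, rfl⟩ := hπ
  have hn : g.nm i x y = p := by
    rw [el_norm] at hN
    exact_mod_cast hN
  have h4 := g.nm4 i x y
  rw [hn] at h4
  have hQ := g.hQ
  have hEA : ¬ p ∣ g.A := fun h => hE (h.mul_right _)
  have hEQ : ¬ p ∣ (4 * g.C - g.A * g.δ ^ 2) := fun h => hE (h.mul_left _)
  cases i
  · simp only [Bool.false_eq_true, if_false] at h4
    have htr : g.el false x y + starRingEnd ℂ (g.el false x y) = ((2 * x + g.A * g.δ * y : ℤ) : ℂ) := by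
      simp [el, g.hrc, g.cjt]
      linear_combination (y * g.δ) * hr
    constructor
    · intro h
      have h5 : (2 * x + g.A * g.δ * y) ^ 2 = 4 * p := by
        have : ((2 * x + g.A * g.δ * y : ℤ) : ℂ) ^ 2 = 4 * p := by
          rw [← htr, ← hN, ← h]; ring
        exact_mod_cast this
      have h6 : y = 0 := by
        have : g.A * (4 * g.C - g.A * g.δ ^ 2) * y ^ 2 = 0 := by linarith
        have h0 : g.A * (4 * g.C - g.A * g.δ ^ 2) ≠ 0 := by linarith
        simpa [h0] using this
      subst h6
      exact hp.irreducible.not_isSquare ⟨x, by linarith⟩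
    · intro h
      have h5 : (2 * x + g.A * g.δ * y) = 0 := by
        have : ((2 * x + g.A * g.δ * y : ℤ) : ℂ) = 0 := by
          rw [← htr]; linear_combination h
        exact_mod_cast this
      rw [h5] at h4
      exact no_sol hp (by linarith) hE hp2 (y := y) (by linarith)
  · simp only [if_true] at h4
    have htr : g.el true x y + starRingEnd ℂ (g.el true x y) = g.r * ((2 * x + g.δ * y : ℤ) : ℂ) := by
      simp [el, g.hrc, g.cjt]
      ring
    constructor
    · intro h
      have h5 : g.A * (2 * x + g.δ * y) ^ 2 = 4 * p := by
        have : g.A * ((2 * x + g.δ * y : ℤ) : ℂ) ^ 2 = 4 * p := by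
          rw [← hr]
          linear_combination (-(g.r * ((2 * x + g.δ * y : ℤ) : ℂ)) - (g.el true x y + starRingEnd ℂ (g.el true x y))) * htr + 4 * hN + (g.el true x y - starRingEnd ℂ (g.el true x y)) * h
        exact_mod_cast this
      have h6 : y = 0 := by
        have : (4 * g.C - g.A * g.δ ^ 2) * y ^ 2 = 0 := by linarith
        have h0 : (4 * g.C - g.A * g.δ ^ 2) ≠ 0 := by linarith
        simpa [h0] using this
      subst h6
      have h7 : g.A ∣ p := ⟨x ^ 2, by linarith⟩
      exact hEA (g.hA.associated_of_dvd hp h7).symm.dvd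
    · intro h
      have h5 : (2 * x + g.δ * y) = 0 := by
        have h8 : g.r * ((2 * x + g.δ * y : ℤ) : ℂ) = 0 := by
          rw [← htr]; linear_combination h
        have hr0 : g.r ≠ 0 := by
          intro h0
          rw [h0, zero_mul] at hr
          exact g.hA.ne_zero (by exact_mod_cast hr.symm)
        have := (mul_eq_zero.mp h8).resolve_left hr0
        exact_mod_cast this
      rw [h5] at h4
      exact no_sol hp hQ hEQ hp2 (y := y) (by linarith)

lemma both {p : ℤ} (hp : Prime p) (hp2 : 2 ≤ p)
    (hE : ¬ p ∣ g.A * (4 * g.C - g.A * g.δ ^ 2)) {π : ℂ} (hπ : g.G π)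
    (hN : π * starRingEnd ℂ π = p) {t : ℂ} (ht : g.G t) (h1 : g.G (t * starRingEnd ℂ π / p))
    (h2 : g.G (t * π / p)) : g.G (t / p) := by
  have hE6 := g.E_six
  have hpc : (p : ℂ) ≠ 0 := by exact_mod_cast hp.ne_zero
  have hns := not_ram hp hp2 hE hπ hN
  obtain ⟨j, hπ⟩ := hπ
  obtain ⟨i, ht'⟩ := id ht
  have h1' : g.Gp (xor i j) (t * starRingEnd ℂ π / p) := by
    apply Gp.of_mul hp.ne_zero _ h1
    convert ht'.mul hπ.conj using 1
    field_simp
  have h2' : g.Gp (xor i j) (t * π / p) := by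
    apply Gp.of_mul hp.ne_zero _ h2
    convert ht'.mul hπ using 1
    field_simp
  have h3 := (h1'.mul hπ.conj).add (h2'.mul hπ)
  have hsq := hπ.mul hπ
  simp only [Bool.xor_self] at hsq
  obtain ⟨x, y, hxy⟩ := hsq
  have htr : π * π + starRingEnd ℂ π * starRingEnd ℂ π = ((2 * x + g.A * g.δ * y : ℤ) : ℂ) := by
    rw [← map_mul, hxy]
    simp [el, g.hrc, g.cjt]
    linear_combination (y * g.δ) * g.hr
  have hn : g.nm false x y = p ^ 2 := by
    have := g.el_norm false x y
    rw [← hxy, map_mul] at this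
    have h5 : (g.nm false x y : ℂ) = p ^ 2 := by
      rw [← this, ← hN]; ring
    exact_mod_cast h5
  have h4 := g.nm4 false x y
  simp only [Bool.false_eq_true, if_false] at h4
  rw [hn] at h4
  set w := 2 * x + g.A * g.δ * y with hw
  by_cases hpw : p ∣ w
  · exfalso
    obtain ⟨a, ha⟩ := hpw
    have hy : p ∣ y := by
      have : p ∣ g.A * (4 * g.C - g.A * g.δ ^ 2) * y ^ 2 := ⟨4 * p - a * w, by
        rw [ha] at h4 ⊢; linarith⟩
      exact hp.dvd_of_dvd_pow ((hp.dvd_or_dvd this).resolve_left hE)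
    obtain ⟨b, hb⟩ := hy
    rw [ha, hb] at h4
    have h6 : a ^ 2 + g.A * (4 * g.C - g.A * g.δ ^ 2) * b ^ 2 = 4 := by
      apply mul_left_cancel₀ (pow_ne_zero 2 hp.ne_zero)
      linarith
    have hb0 : b = 0 := by
      by_contra hb0
      have : 1 ≤ b ^ 2 := by have := sq_pos_of_ne_zero hb0; omega
      nlinarith [sq_nonneg a]
    rw [hb0] at h6
    have h7 : (a - 2) * (a + 2) = 0 := by linarith
    rcases mul_eq_zero.mp h7 with h7 | h7
    · have : a = 2 := by omega
      rw [ha, this] at htr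
      push_cast at htr
      rw [← hN] at htr
      apply hns.1
      have : (π - starRingEnd ℂ π) ^ 2 = 0 := by linear_combination htr
      exact sub_eq_zero.mp (by simpa using this)
    · have : a = -2 := by omega
      rw [ha, this] at htr
      push_cast at htr
      rw [← hN] at htr
      apply hns.2
      have : (π + starRingEnd ℂ π) ^ 2 = 0 := by linear_combination htr
      exact eq_neg_of_add_eq_zero_left (by simpa using this)
  · apply G.bez hp.ne_zero (cop hp hpw)
    · convert ht using 1
      field_simp
    · refine ⟨xor (xor i j) j, ?_⟩
      convert h3 using 1
      rw [← htr]
      ring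

lemma card_F_split {p : ℕ} (hp : p.Prime)
    (hE : ¬ (p : ℤ) ∣ g.A * (4 * g.C - g.A * g.δ ^ 2)) {π : ℂ} (hπ : g.G π)
    (hN : π * starRingEnd ℂ π = p) {t : ℂ} {n : ℕ} (ht : t ∈ g.SF (p * n)) [Decidable (g.G (t / p))] :
    (g.F p t).card = if g.G (t / p) then 4 else 2 := by
  classical
  rw [mem_SF] at ht
  have hpi := Nat.prime_iff_prime_int.mp hp
  have hp2 : (2 : ℤ) ≤ p := by exact_mod_cast hp.two_le
  have hpc : (p : ℂ) ≠ 0 := by exact_mod_cast hp.ne_zero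
  have hN' : π * starRingEnd ℂ π = ((p : ℤ) : ℂ) := by simpa using hN
  have hNc : starRingEnd ℂ π * starRingEnd ℂ (starRingEnd ℂ π) = p := by
    rw [Complex.conj_conj, mul_comm, hN]
  have hns := not_ram hpi hp2 hE hπ hN'
  have h0 := ne_neg hp.pos hN
  have h0c := ne_neg hp.pos hNc
  have hall : ∀ w, g.G w → w * starRingEnd ℂ w = p →
      (w = π ∨ w = -π) ∨ (w = starRingEnd ℂ π ∨ w = -starRingEnd ℂ π) := by
    intro w hw hwn
    rcases PR hpi hπ hN' hw (m := p) (by simpa using hwn) dvd_rfl with h | h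
    · exact Or.inl (assoc (g := g) hp.pos hwn hN (by simpa using h))
    · exact Or.inr (assoc (g := g) hp.pos hwn hNc (by simpa using h))
  split_ifs with h
  · have : g.F p t = {π, -π, starRingEnd ℂ π, -starRingEnd ℂ π} := by
      ext w
      rw [mem_F]
      simp only [Finset.mem_insert, Finset.mem_singleton]
      constructor
      · rintro ⟨⟨h1, h2⟩, h3⟩
        have := hall w h1 h2
        tauto
      · intro hw
        have hw' : g.G w ∧ w * starRingEnd ℂ w = p := by
          rcases hw with rfl | rfl | rfl | rfl
          · exact ⟨hπ, hN⟩
          · exact ⟨hπ.neg, by simpa using hN⟩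
          · exact ⟨hπ.conj, hNc⟩
          · exact ⟨hπ.conj.neg, by simpa using hNc⟩
        refine ⟨hw', ?_⟩
        convert h.mul hw'.1.conj using 1
        ring
    rw [this]
    have e1 : -π ≠ starRingEnd ℂ π := fun h => hns.2 (by rw [← h, neg_neg])
    have e2 : -π ≠ -starRingEnd ℂ π := fun h => hns.1 (neg_injective h)
    rw [Finset.card_insert_of_notMem (by simp [h0.2, hns.1, hns.2]),
      Finset.card_insert_of_notMem (by simp only [Finset.mem_insert, Finset.mem_singleton]; tauto),
      Finset.card_pair h0c.2]
  · have hor := PR hpi hπ hN' ht.1 (m := (p * n : ℕ)) (by rw [ht.2]; simp)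
      (by push_cast; exact Dvd.intro _ rfl)
    push_cast at hor
    have hnb : ¬ (g.G (t * starRingEnd ℂ π / p) ∧ g.G (t * π / p)) := by
      rintro ⟨h1, h2⟩
      apply h
      simpa using both hpi hp2 hE hπ hN' ht.1 (by simpa using h1) (by simpa using h2)
    have key : ∀ ρ, g.G ρ → ρ * starRingEnd ℂ ρ = p → g.G (t * starRingEnd ℂ ρ / p) →
        (∀ w, g.G w → w * starRingEnd ℂ w = p → g.G (t * starRingEnd ℂ w / p) → w = ρ ∨ w = -ρ) →
        (g.F p t).card = 2 := by
      intro ρ h1 h2 h3 h4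
      have : g.F p t = {ρ, -ρ} := by
        ext w
        rw [mem_F]
        simp only [Finset.mem_insert, Finset.mem_singleton]
        constructor
        · rintro ⟨⟨h5, h6⟩, h7⟩
          exact h4 w h5 h6 h7
        · rintro (rfl | rfl)
          · exact ⟨⟨h1, h2⟩, h3⟩
          · refine ⟨⟨h1.neg, by simpa using h2⟩, ?_⟩
            convert h3.neg using 1
            simp; ring
      rw [this, Finset.card_pair (ne_neg hp.pos h2).2]
    have nn : ∀ u : ℂ, g.G (t * (-u) / p) → g.G (t * u / p) := by
      intro u hu
      convert hu.neg using 1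
      ring
    rcases hor with h1 | h1
    · refine key π hπ hN h1 ?_
      intro w h2 h3 h4
      rcases hall w h2 h3 with h5 | h5
      · exact h5
      · exfalso
        rcases h5 with rfl | rfl
        · rw [Complex.conj_conj] at h4
          exact hnb ⟨h1, h4⟩
        · rw [map_neg, Complex.conj_conj] at h4
          exact hnb ⟨h1, nn _ h4⟩
    · refine key _ hπ.conj hNc (by rwa [Complex.conj_conj]) ?_
      intro w h2 h3 h4
      rcases hall w h2 h3 with h5 | h5
      · exfalso
        rcases h5 with rfl | rfl
        · exact hnb ⟨h4, h1⟩
        · rw [map_neg] at h4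
          exact hnb ⟨nn _ h4, h1⟩
      · exact h5

lemma T_hecke {p : ℕ} (hp : p.Prime)
    (hE : ¬ (p : ℤ) ∣ g.A * (4 * g.C - g.A * g.δ ^ 2)) {k : ℤ} (hk : (p : ℤ) ∣ g.nm false k 1)
    (n : ℕ) : g.T p * g.T (p * n) = 2 * g.T (p * (p * n)) + 2 * p ^ 2 * g.T n := by
  classical
  have hpi := Nat.prime_iff_prime_int.mp hp
  have hpc : (p : ℂ) ≠ 0 := by exact_mod_cast hp.ne_zero
  obtain ⟨π, h1, h2⟩ := exists_pi hpi (by exact_mod_cast hp.pos) hk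
  rw [conv _ _ hp.pos]
  have e1 : ∑ t ∈ g.SF (p * (p * n)), ((g.F p t).card : ℂ) * t ^ 2
      = ∑ t ∈ g.SF (p * (p * n)), (2 * t ^ 2 + if g.G (t / p) then 2 * t ^ 2 else 0) := by
    apply Finset.sum_congr rfl
    intro t ht
    rw [card_F_split hp hE h1 (by simpa using h2) ht]
    split_ifs <;> push_cast <;> ring
  rw [e1, Finset.sum_add_distrib, ← Finset.mul_sum, ← Finset.sum_filter]
  congr 1
  rw [T, Finset.mul_sum]
  apply Finset.sum_bij' (fun t _ => t / (p : ℂ)) (fun s _ => (p : ℂ) * s)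
  · intro t ht
    rw [Finset.mem_filter, mem_SF] at ht
    rw [mem_SF]
    refine ⟨ht.2, ?_⟩
    rw [map_div₀, map_natCast]
    have := ht.1.2
    push_cast at this
    field_simp
    rw [this]; ring
  · intro s hs
    rw [mem_SF] at hs
    rw [Finset.mem_filter, mem_SF]
    refine ⟨⟨by simpa using hs.1.zmul p, ?_⟩, ?_⟩
    · rw [map_mul, map_natCast]
      push_cast
      linear_combination p * p * hs.2
    · convert hs.1 using 1
      field_simp
  · intro t ht
    field_simp
  · intro s hs
    field_simp
  · intro t ht
    field_simp

end GD

namespace GD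
variable {g : GD}

variable (g) in
def V (i : Bool) (x y : ℤ) : ℚ :=
  if i then (g.A * (2 * x + g.δ * y) ^ 2 - (4 * g.C - g.A * g.δ ^ 2) * y ^ 2) / 4
  else ((2 * x + g.A * g.δ * y) ^ 2 - g.A * (4 * g.C - g.A * g.δ ^ 2) * y ^ 2) / 4

lemma el_re (i : Bool) (x y : ℤ) : (g.el i x y ^ 2).re = (g.V i x y : ℝ) := by
  have hr := g.hr
  have hn := g.el_norm i x y
  have h4 : (4 * g.nm i x y : ℂ) = ((4 * g.nm i x y : ℤ) : ℂ) := by push_cast; rfl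
  rw [nm4] at h4
  have h : g.el i x y ^ 2 + starRingEnd ℂ (g.el i x y ^ 2) = 2 * ((g.V i x y : ℝ) : ℂ) := by
    cases i
    · have htr : g.el false x y + starRingEnd ℂ (g.el false x y) = (2 * x + g.A * g.δ * y : ℂ) := by
        simp [el, g.hrc, g.cjt]
        linear_combination (y * g.δ) * hr
      simp only [Bool.false_eq_true, if_false] at h4
      simp only [V, Bool.false_eq_true, if_false]
      rw [map_pow]
      push_cast at h4 ⊢
      linear_combination (g.el false x y + starRingEnd ℂ (g.el false x y) + (2 * x + g.A * g.δ * y : ℂ)) * htr - 2 * hn - h4 / 2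
    · have htr : g.el true x y + starRingEnd ℂ (g.el true x y) = g.r * (2 * x + g.δ * y : ℂ) := by
        simp [el, g.hrc, g.cjt]
        ring
      simp only [if_true] at h4
      simp only [V, if_true]
      rw [map_pow]
      push_cast at h4 ⊢
      linear_combination (g.el true x y + starRingEnd ℂ (g.el true x y) + g.r * (2 * x + g.δ * y : ℂ)) * htr - 2 * hn - h4 / 2 + (2 * x + g.δ * y : ℂ) ^ 2 * hr
  rw [Complex.add_conj] at h
  have h' : 2 * (g.el i x y ^ 2).re = 2 * (g.V i x y : ℝ) := by exact_mod_cast h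
  linarith

lemma el_inj (i : Bool) : Function.Injective (fun p : ℤ × ℤ => g.el i p.1 p.2) := by
  rintro ⟨x, y⟩ ⟨u, v⟩ h
  simp only at h
  have h0 : g.el i (x - u) (y - v) = 0 := by
    have : g.el i (x - u) (y - v) = g.el i x y - g.el i u v := by
      cases i <;> simp [el] <;> ring
    rw [this, h, sub_self]
  have hn := g.el_norm i (x - u) (y - v)
  rw [h0, zero_mul] at hn
  have hn : g.nm i (x - u) (y - v) = 0 := by exact_mod_cast hn.symm
  have h1 := g.nm_x i (x - u) (y - v)
  have h2 := g.nm_y i (x - u) (y - v)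
  rw [hn, mul_zero] at h1 h2
  have h1' := pow_eq_zero_iff two_ne_zero |>.mp (le_antisymm h1 (sq_nonneg _))
  have h2' := pow_eq_zero_iff two_ne_zero |>.mp (le_antisymm h2 (sq_nonneg _))
  ext
  · simp only; omega
  · simp only; omega

lemma T_eq {m : ℕ} (hm : 0 < m) :
    g.T m = (((∑ᶠ p ∈ {p : ℤ × ℤ | g.nm false p.1 p.2 = m}, g.V false p.1 p.2)
      + (∑ᶠ p ∈ {p : ℤ × ℤ | g.nm true p.1 p.2 = m}, g.V true p.1 p.2) : ℚ) : ℂ) := by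
  classical
  rw [finsum_mem_eq_finite_toFinset_sum _ (nm_fin false m),
    finsum_mem_eq_finite_toFinset_sum _ (nm_fin true m)]
  have him : (g.T m).im = 0 := by
    rw [← Complex.conj_eq_iff_im, T, map_sum]
    apply Finset.sum_bij' (fun z _ => starRingEnd ℂ z) (fun z _ => starRingEnd ℂ z)
    · intro z hz
      rw [mem_SF] at hz ⊢
      exact ⟨hz.1.conj, by rw [Complex.conj_conj, mul_comm]; exact hz.2⟩
    · intro z hz
      rw [mem_SF] at hz ⊢
      exact ⟨hz.1.conj, by rw [Complex.conj_conj, mul_comm]; exact hz.2⟩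
    · simp
    · simp
    · simp
  have hSF : g.SF m = ((g.nm_fin false m).toFinset.image fun p : ℤ × ℤ => g.el false p.1 p.2)
      ∪ ((g.nm_fin true m).toFinset.image fun p : ℤ × ℤ => g.el true p.1 p.2) := by
    apply Finset.coe_injective
    simp only [SF, Set.Finite.coe_toFinset, Finset.coe_union, Finset.coe_image]
    exact S_eq m
  have hre : (g.T m).re = ((∑ i ∈ (g.nm_fin false m).toFinset, g.V false i.1 i.2
      + ∑ i ∈ (g.nm_fin true m).toFinset, g.V true i.1 i.2 : ℚ) : ℝ) := by
    rw [T, hSF, Finset.sum_union, Finset.sum_image (fun _ _ _ _ h => el_inj _ h),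
      Finset.sum_image (fun _ _ _ _ h => el_inj _ h), Complex.add_re, Complex.re_sum, Complex.re_sum]
    · simp only [el_re]
      push_cast
      rfl
    · rw [Finset.disjoint_left]
      intro z h1 h2
      rw [Finset.mem_image] at h1 h2
      obtain ⟨p, hp, rfl⟩ := h1
      obtain ⟨q, hq, h⟩ := h2
      have h0 := disj (g := g) ⟨p.1, p.2, rfl⟩ ⟨q.1, q.2, h.symm⟩
      have hn := g.el_norm false p.1 p.2
      rw [h0, zero_mul] at hn
      have hn : g.nm false p.1 p.2 = 0 := by exact_mod_cast hn.symm
      simp only [Set.Finite.mem_toFinset, Set.mem_ofPred_eq] at hp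
      omega
  apply Complex.ext
  · rw [hre]; norm_cast
  · rw [him]; norm_cast

lemma split_k {p : ℕ} (hp : Fact p.Prime) {D : ℤ}
    (hD : D = -(g.A * (4 * g.C - g.A * g.δ ^ 2)))
    (h : (p ≠ 2 ∧ legendreSym p D = 1) ∨ (p = 2 ∧ D % 8 = 1)) :
    ¬ (p : ℤ) ∣ g.A * (4 * g.C - g.A * g.δ ^ 2) ∧ ∃ k, (p : ℤ) ∣ g.nm false k 1 := by
  rcases h with ⟨h2, h⟩ | ⟨rfl, h⟩
  · have h0 : ((D : ℤ) : ZMod p) ≠ 0 := by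
      intro h0
      rw [(legendreSym.eq_zero_iff p D).mpr h0] at h
      exact zero_ne_one h
    obtain ⟨b, hb⟩ := (legendreSym.eq_one_iff p h0).mp h
    have h20 : (2 : ZMod p) ≠ 0 := by
      intro h3
      have : ((2 : ℕ) : ZMod p) = 0 := by exact_mod_cast h3
      rw [ZMod.natCast_eq_zero_iff] at this
      exact h2 ((Nat.prime_dvd_prime_iff_eq hp.out Nat.prime_two).mp this)
    constructor
    · intro h3
      apply h0
      rw [ZMod.intCast_zmod_eq_zero_iff_dvd, hD]
      exact (dvd_neg).mpr h3
    · refine ⟨(((b - g.A * g.δ) / 2 : ZMod p).val : ℤ), ?_⟩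
      rw [← ZMod.intCast_zmod_eq_zero_iff_dvd]
      have hv : ((((b - g.A * g.δ) / 2 : ZMod p).val : ℕ) : ZMod p) = (b - g.A * g.δ) / 2 :=
        ZMod.natCast_zmod_val _
      simp only [nm, Bool.false_eq_true, if_false]
      push_cast
      rw [hv]
      rw [hD] at hb
      push_cast at hb
      field_simp
      linear_combination -hb
  · set Q := g.A * (4 * g.C - g.A * g.δ ^ 2) with hQ
    have hodd : Q % 2 = 1 := by omega
    constructor
    · push_cast; omega
    · refine ⟨0, ?_⟩
      simp [nm]
      have h1 : (g.A * g.δ) ^ 2 = 4 * (g.A * g.C) + D := by rw [hD, hQ]; ring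
      have h3 : (g.A * g.δ) % 2 = 1 := by
        rcases Int.emod_two_eq_zero_or_one (g.A * g.δ) with h4 | h4
        · exfalso
          obtain ⟨c, hc⟩ := Int.dvd_of_emod_eq_zero h4
          rw [hc, mul_pow] at h1
          omega
        · exact h4
      have h5 := Int.sq_mod_four_eq_one_of_odd (Int.odd_iff.mpr h3)
      have h6 : (g.A * g.δ) ^ 2 % 8 = 1 := by
        obtain ⟨c, hc⟩ := Int.odd_iff.mpr h3
        obtain ⟨e, he⟩ := Int.even_mul_succ_self c
        have : (g.A * g.δ) ^ 2 = 8 * e + 1 := by rw [hc]; linear_combination 4 * he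
        omega
      omega

theorem of_data (g : GD) (d : ℕ) (s e : ℤ) (σ : ℤ × ℤ → ℤ × ℤ)
    (hσ : Function.Involutive σ)
    (hQ : ∀ a b, Qf d (a, b) = g.nm false (a - s * b) b)
    (hV : ∀ a b, Vf d (a, b) = g.V false (a - s * b) b)
    (hf : ∀ x y, fnp d (x, y) = g.nm true x (y - e * x))
    (hfσ : ∀ p, fnp d (σ p) = fnp d p)
    (hW : ∀ p : ℤ × ℤ, c2 d * (Vnp d p + Vnp d (σ p)) =
      (1 / 2) * (g.V true p.1 (p.2 - e * p.1) + g.V true (σ p).1 ((σ p).2 - e * (σ p).1)))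
    (hD : discK d = -(g.A * (4 * g.C - g.A * g.δ ^ 2)))
    (b : ℕ → ℚ)
    (hb : ∀ m, 0 < m → b m =
      (1 / 2) * (∑ᶠ p ∈ shell d m, Vf d p) + c2 d * (∑ᶠ p ∈ shellNp d m, Vnp d p)) :
    b 1 = 1 ∧
    (∀ m n : ℕ, 0 < m → 0 < n → Nat.Coprime m n → b (m * n) = b m * b n) ∧
    (∀ (p : ℕ) (hp : Fact p.Prime),
      ((p ≠ 2 ∧ legendreSym p (discK d) = 1) ∨ (p = 2 ∧ discK d % 8 = 1)) →
      ∀ α : ℕ, 1 ≤ α →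
        b (p ^ (α + 1)) = b p * b (p ^ α) - (p : ℚ) ^ 2 * b (p ^ (α - 1))) := by
  have key : ∀ m, 0 < m → (b m : ℂ) = g.T m / 2 := by
    intro m hm
    rw [T_eq hm, hb m hm]
    have bij1 : Set.BijOn (fun p : ℤ × ℤ => (p.1 - s * p.2, p.2)) (shell d m)
        {p : ℤ × ℤ | g.nm false p.1 p.2 = m} := by
      refine ⟨?_, ?_, ?_⟩
      · rintro ⟨x, y⟩ h
        have h : Qf d (x, y) = m := h
        rw [hQ] at h
        exact h
      · rintro ⟨x, y⟩ _ ⟨u, v⟩ _ h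
        simp only [Prod.mk.injEq] at h
        obtain ⟨h1, rfl⟩ := h
        ext
        · simp only; linarith
        · rfl
      · rintro ⟨x, y⟩ h
        refine ⟨(x + s * y, y), ?_, by simp⟩
        have h : g.nm false x y = m := h
        show Qf d (x + s * y, y) = m
        rw [hQ, add_sub_cancel_right, h]
    have bij2 : Set.BijOn (fun p : ℤ × ℤ => (p.1, p.2 - e * p.1)) (shellNp d m)
        {p : ℤ × ℤ | g.nm true p.1 p.2 = m} := by
      refine ⟨?_, ?_, ?_⟩
      · rintro ⟨x, y⟩ h
        have h : fnp d (x, y) = m := h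
        rw [hf] at h
        exact h
      · rintro ⟨x, y⟩ _ ⟨u, v⟩ _ h
        simp only [Prod.mk.injEq] at h
        obtain ⟨rfl, h1⟩ := h
        ext
        · rfl
        · simp only; linarith
      · rintro ⟨x, y⟩ h
        refine ⟨(x, y + e * x), ?_, by simp⟩
        have h : g.nm true x y = m := h
        show fnp d (x, y + e * x) = m
        rw [hf, add_sub_cancel_right, h]
    have e1 := finsum_mem_eq_of_bijOn (f := Vf d) (g := fun p : ℤ × ℤ => g.V false p.1 p.2) _ bij1
      (fun p _ => hV p.1 p.2)
    have e2 := finsum_mem_eq_of_bijOn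
      (f := fun p : ℤ × ℤ => g.V true p.1 (p.2 - e * p.1))
      (g := fun p : ℤ × ℤ => g.V true p.1 p.2) _ bij2 (fun p _ => rfl)
    have hfin : (shellNp d m).Finite :=
      Set.Finite.of_finite_image ((nm_fin true m).subset bij2.image_eq.subset) bij2.injOn
    have bij3 : Set.BijOn σ (shellNp d m) (shellNp d m) := by
      have hmap : Set.MapsTo σ (shellNp d m) (shellNp d m) := by
        intro p h
        show fnp d (σ p) = m
        rw [hfσ]; exact h
      exact ⟨hmap, hσ.injective.injOn, fun p h => ⟨σ p, hmap h, hσ p⟩⟩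
    have inv : ∀ f : ℤ × ℤ → ℚ, ∑ᶠ p ∈ shellNp d m, (f p + f (σ p))
        = 2 * ∑ᶠ p ∈ shellNp d m, f p := by
      intro f
      rw [finsum_mem_add_distrib hfin,
        finsum_mem_eq_of_bijOn (f := fun p => f (σ p)) (g := f) σ bij3 (fun _ _ => rfl)]
      ring
    have e3 : c2 d * (∑ᶠ p ∈ shellNp d m, Vnp d p)
        = (1 / 2) * ∑ᶠ p ∈ shellNp d m, g.V true p.1 (p.2 - e * p.1) := by
      have i1 := inv (Vnp d)
      have i2 := inv (fun p : ℤ × ℤ => g.V true p.1 (p.2 - e * p.1))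
      have : c2 d * ∑ᶠ p ∈ shellNp d m, (Vnp d p + Vnp d (σ p)) = (1 / 2) *
          ∑ᶠ p ∈ shellNp d m, (g.V true p.1 (p.2 - e * p.1)
            + g.V true (σ p).1 ((σ p).2 - e * (σ p).1)) := by
        rw [finsum_mem_eq_finite_toFinset_sum _ hfin, finsum_mem_eq_finite_toFinset_sum _ hfin,
          Finset.mul_sum, Finset.mul_sum]
        exact Finset.sum_congr rfl fun p _ => hW p
      rw [i1, i2] at this
      linarith
    rw [e3, e1, e2]
    push_cast
    ring
  refine ⟨?_, ?_, ?_⟩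
  · have := key 1 one_pos
    rw [T_one] at this
    norm_num at this
    exact_mod_cast this
  · intro m n hm hn hc
    have h := T_mul (g := g) hm hc
    have : (b (m * n) : ℂ) = b m * b n := by
      rw [key _ hm, key _ hn, key _ (Nat.mul_pos hm hn)]
      linear_combination (-1 / 4) * h
    exact_mod_cast this
  · intro p hp h α hα
    obtain ⟨hE, k, hk⟩ := split_k hp hD h
    obtain ⟨β, rfl⟩ : ∃ β, α = β + 1 := ⟨α - 1, by omega⟩
    have h1 := T_hecke hp.out hE hk (p ^ β)
    have hp0 := hp.out.pos
    have : (b (p ^ (β + 1 + 1)) : ℂ) = b p * b (p ^ (β + 1)) - (p : ℂ) ^ 2 * b (p ^ (β + 1 - 1)) := by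
      rw [key _ hp0, key _ (pow_pos hp0 _), key _ (pow_pos hp0 _), key _ (pow_pos hp0 _)]
      have q1 : p ^ (β + 1 + 1) = p * (p * p ^ β) := by ring
      have q2 : p ^ (β + 1) = p * p ^ β := by ring
      rw [q1, q2, Nat.add_sub_cancel]
      linear_combination (-1 / 4) * h1
    exact_mod_cast this

end GD

def chkForm (A E : ℤ) : Bool :=
  (List.range 11).all fun k => (List.range 23).all fun j =>
    let a : ℤ := (k : ℤ) + 1
    let b : ℤ := (j : ℤ) - 11
    let c : ℤ := (b * b + E) / (4 * a)
    !(decide (4 * a * c = b * b + E ∧ a ≤ c ∧ b ≤ a ∧ -a ≤ b)) ||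
      ([-1, 0, 1] : List ℤ).any fun x => ([-1, 0, 1] : List ℤ).any fun y =>
        decide (a * x ^ 2 + b * x * y + c * y ^ 2 = 1) ||
          decide (a * x ^ 2 + b * x * y + c * y ^ 2 = A)

lemma chk_red {A E : ℤ} (hE : E < 432) (h : chkForm A E = true) (a b c : ℤ) (ha : 0 < a)
    (hb1 : b ≤ a) (hb2 : -a ≤ b) (hac : a ≤ c) (hd : b ^ 2 - 4 * a * c = -E) :
    ∃ x y : ℤ, a * x ^ 2 + b * x * y + c * y ^ 2 = 1 ∨ a * x ^ 2 + b * x * y + c * y ^ 2 = A := by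
  have ha12 : a < 12 := by
    by_contra hh
    nlinarith [mul_nonneg (sub_nonneg.mpr hb1) (by linarith : 0 ≤ a + b)]
  unfold chkForm at h
  rw [List.all_eq_true] at h
  have h1 := h (a - 1).toNat (by rw [List.mem_range]; omega)
  rw [List.all_eq_true] at h1
  have h2 := h1 (b + 11).toNat (by rw [List.mem_range]; omega)
  have ea : (((a - 1).toNat : ℕ) : ℤ) + 1 = a := by omega
  have eb : (((b + 11).toNat : ℕ) : ℤ) - 11 = b := by omega
  have ec : (b * b + E) / (4 * a) = c := by
    apply Int.ediv_eq_of_eq_mul_right (by omega)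
    linarith
  simp only [ea, eb, ec] at h2
  have hcond : 4 * a * c = b * b + E ∧ a ≤ c ∧ b ≤ a ∧ -a ≤ b := ⟨by linarith, hac, hb1, hb2⟩
  rw [decide_eq_true hcond] at h2
  simp only [Bool.not_true, Bool.false_or, List.any_eq_true, Bool.or_eq_true, decide_eq_true_eq] at h2
  obtain ⟨x, _, y, _, hxy⟩ := h2
  exact ⟨x, y, hxy⟩

lemma chk_all {A E : ℤ} (hE0 : 0 < E) (hE : E < 432) (h : chkForm A E = true) :
    ∀ (n : ℕ) (a b c : ℤ), a.toNat = n → 0 < a → b ^ 2 - 4 * a * c = -E →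
    ∃ x y : ℤ, a * x ^ 2 + b * x * y + c * y ^ 2 = 1 ∨ a * x ^ 2 + b * x * y + c * y ^ 2 = A := by
  intro n
  induction n using Nat.strong_induction_on with
  | _ n ih =>
  intro a b c hn ha hd
  obtain ⟨k, hk1, hk2⟩ : ∃ k : ℤ, b + 2 * a * k ≤ a ∧ -a ≤ b + 2 * a * k := by
    refine ⟨-((b + a) / (2 * a)), ?_, ?_⟩
    · have := Int.emod_lt_of_pos (b + a) (by omega : 0 < 2 * a)
      have := Int.mul_ediv_add_emod (b + a) (2 * a)
      linarith
    · have := Int.emod_nonneg (b + a) (by omega : 2 * a ≠ 0)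
      have := Int.mul_ediv_add_emod (b + a) (2 * a)
      linarith
  set B := b + 2 * a * k with hB
  set C := a * k ^ 2 + b * k + c with hC
  have hd' : B ^ 2 - 4 * a * C = -E := by rw [hB, hC]; linarith
  suffices hs : ∃ x y : ℤ, a * x ^ 2 + B * x * y + C * y ^ 2 = 1 ∨
      a * x ^ 2 + B * x * y + C * y ^ 2 = A by
    obtain ⟨x, y, hxy⟩ := hs
    refine ⟨x + k * y, y, ?_⟩
    have : a * (x + k * y) ^ 2 + b * (x + k * y) * y + c * y ^ 2
        = a * x ^ 2 + B * x * y + C * y ^ 2 := by rw [hB, hC]; ring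
    rwa [this]
  by_cases hc : a ≤ C
  · exact chk_red hE h a B C ha hk1 hk2 hc hd'
  · have hC0 : 0 < C := by
      by_contra hh
      nlinarith [sq_nonneg B]
    obtain ⟨x, y, hxy⟩ := ih C.toNat (by omega) C B a rfl hC0 (by linarith)
    refine ⟨y, x, ?_⟩
    have : a * y ^ 2 + B * y * x + C * x ^ 2 = C * x ^ 2 + B * x * y + a * y ^ 2 := by ring
    rwa [this]

noncomputable def mkGD (A δ C : ℤ) (hA : Prime A) (hA0 : 0 < A)
    (hQ : 3 ≤ 4 * C - A * δ ^ 2) (hQ4 : 4 * C - A * δ ^ 2 ≠ 4) (hAC : ¬ A ∣ C)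
    (hE : A * (4 * C - A * δ ^ 2) < 432)
    (hchk : chkForm A (A * (4 * C - A * δ ^ 2)) = true) : GD where
  A := A
  δ := δ
  C := C
  r := (Real.sqrt A : ℝ)
  τ := ⟨δ * Real.sqrt A / 2, Real.sqrt ((4 * C - A * δ ^ 2 : ℤ) : ℝ) / 2⟩
  hA := hA
  hA0 := hA0
  hr := by
    rw [← Complex.ofReal_mul, Real.mul_self_sqrt (by exact_mod_cast hA0.le)]
    simp
  hrc := Complex.conj_ofReal _
  htr := by
    apply Complex.ext
    · simp
    · simp
  hnm := by
    have h1 : Real.sqrt A ^ 2 = A := Real.sq_sqrt (by exact_mod_cast hA0.le)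
    have h2 : Real.sqrt ((4 * C - A * δ ^ 2 : ℤ) : ℝ) ^ 2 = ((4 * C - A * δ ^ 2 : ℤ) : ℝ) :=
      Real.sq_sqrt (by have : 0 ≤ 4 * C - A * δ ^ 2 := by linarith
                       exact_mod_cast this)
    rw [Complex.mul_conj]
    have : Complex.normSq ⟨δ * Real.sqrt A / 2, Real.sqrt ((4 * C - A * δ ^ 2 : ℤ) : ℝ) / 2⟩ = (C : ℝ) := by
      rw [Complex.normSq_mk]
      push_cast at h2 ⊢
      linear_combination (δ ^ 2 / 4 : ℝ) * h1 + h2 / 4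
    rw [this]
    simp
  hQ := hQ
  hQ4 := hQ4
  hAC := hAC
  hCP := by
    intro a b c ha h
    have h0 : 0 < A * (4 * C - A * δ ^ 2) := mul_pos hA0 (by linarith)
    exact chk_all h0 hE hchk _ a b c rfl ha (by rw [h]; ring)


theorem wrap (A δ C : ℤ) (d : ℕ) (s e : ℤ) (σ : ℤ × ℤ → ℤ × ℤ)
    (hσ : Function.Involutive σ) (hA : Nat.Prime A.toNat)
    (h1 : 3 ≤ 4 * C - A * δ ^ 2 ∧ 4 * C - A * δ ^ 2 ≠ 4 ∧ ¬ A ∣ C ∧ A * (4 * C - A * δ ^ 2) < 432)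
    (hchk : chkForm A (A * (4 * C - A * δ ^ 2)) = true)
    (hQ : ∀ a b, Qf d (a, b) = (a - s * b) ^ 2 + A * δ * (a - s * b) * b + A * C * b ^ 2)
    (hV : ∀ a b, Vf d (a, b) =
      ((2 * (a - s * b) + A * δ * b) ^ 2 - A * (4 * C - A * δ ^ 2) * b ^ 2) / 4)
    (hf : ∀ x y, fnp d (x, y) = A * x ^ 2 + A * δ * x * (y - e * x) + C * (y - e * x) ^ 2)
    (hfσ : ∀ p, fnp d (σ p) = fnp d p)
    (hW : ∀ p : ℤ × ℤ, c2 d * (Vnp d p + Vnp d (σ p)) = (1 / 2) *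
      ((A * (2 * p.1 + δ * (p.2 - e * p.1)) ^ 2 - (4 * C - A * δ ^ 2) * (p.2 - e * p.1) ^ 2) / 4 +
       (A * (2 * (σ p).1 + δ * ((σ p).2 - e * (σ p).1)) ^ 2
          - (4 * C - A * δ ^ 2) * ((σ p).2 - e * (σ p).1) ^ 2) / 4))
    (hD : discK d = -(A * (4 * C - A * δ ^ 2)))
    (b : ℕ → ℚ)
    (hb : ∀ m, 0 < m → b m =
      (1 / 2) * (∑ᶠ p ∈ shell d m, Vf d p) + c2 d * (∑ᶠ p ∈ shellNp d m, Vnp d p)) :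
    b 1 = 1 ∧
    (∀ m n : ℕ, 0 < m → 0 < n → Nat.Coprime m n → b (m * n) = b m * b n) ∧
    (∀ (p : ℕ) (hp : Fact p.Prime),
      ((p ≠ 2 ∧ legendreSym p (discK d) = 1) ∨ (p = 2 ∧ discK d % 8 = 1)) →
      ∀ α : ℕ, 1 ≤ α →
        b (p ^ (α + 1)) = b p * b (p ^ α) - (p : ℚ) ^ 2 * b (p ^ (α - 1))) := by
  have hA0 : 0 < A := by have := hA.pos; omega
  have hA' : Prime A := by
    have := Nat.prime_iff_prime_int.mp hA
    rwa [Int.toNat_of_nonneg hA0.le] at this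
  refine GD.of_data (mkGD A δ C hA' hA0 h1.1 h1.2.1 h1.2.2.1 h1.2.2.2 hchk) d s e σ hσ
    ?_ ?_ ?_ hfσ ?_ hD b hb
  · intro a b
    rw [hQ]; rfl
  · intro a b
    rw [hV]
    simp [GD.V, mkGD]
  · intro x y
    rw [hf]; rfl
  · intro p
    rw [hW]
    simp [GD.V, mkGD]


/-- For `d` in the list of squarefree values with `ℚ(√−d)` of class number 2, the function
`b_d(m) = (1/2)·∑_{(a,b) ∈ S_d(m)} V_d(a,b) + c₂(d)·∑_{(x,y) ∈ S^a_d(m)} V^a_d(x,y)`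
satisfies `b_d(1) = 1`; `b_d(m·n) = b_d(m)·b_d(n)` for coprime positive integers `m, n`;
and the Hecke recurrence `b_d(p^{α+1}) = b_d(p)·b_d(p^α) − p²·b_d(p^{α−1})` for every
`α ≥ 1` and every prime `p` such that either `p` is odd and `(d_K/p) = 1`, or `p = 2` and
`d_K ≡ 1 (mod 8)`. -/
theorem stmt_16 (d : ℕ)
    (hd : d ∈ ({5, 6, 10, 13, 15, 22, 35, 37, 51, 58, 91, 115, 123, 187, 235, 267, 403, 427} :
      Finset ℕ))
    (b : ℕ → ℚ)
    (hb : ∀ m, 0 < m → b m =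
      (1 / 2) * (∑ᶠ p ∈ shell d m, Vf d p) + c2 d * (∑ᶠ p ∈ shellNp d m, Vnp d p)) :
    b 1 = 1 ∧
    (∀ m n : ℕ, 0 < m → 0 < n → Nat.Coprime m n → b (m * n) = b m * b n) ∧
    (∀ (p : ℕ) (hp : Fact p.Prime),
      ((p ≠ 2 ∧ legendreSym p (discK d) = 1) ∨ (p = 2 ∧ discK d % 8 = 1)) →
      ∀ α : ℕ, 1 ≤ α →
        b (p ^ (α + 1)) = b p * b (p ^ α) - (p : ℚ) ^ 2 * b (p ^ (α - 1))) := by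
  simp only [Finset.mem_insert, Finset.mem_singleton] at hd
  rcases hd with rfl | rfl | rfl | rfl | rfl | rfl | rfl | rfl | rfl | rfl | rfl | rfl | rfl | rfl | rfl | rfl | rfl | rfl
  · refine wrap 2 1 3 5 1 0 id (fun _ => rfl) (by decide +kernel) (by norm_num) (by decide +kernel)
      ?_ ?_ ?_ ?_ ?_ (by norm_num [discK]) b hb
    all_goals intros; simp [Qf, Vf, fnp, npABC, Vnp, c2]; try ring
  · refine wrap 2 0 3 6 0 0 id (fun _ => rfl) (by decide +kernel) (by norm_num) (by decide +kernel)
      ?_ ?_ ?_ ?_ ?_ (by norm_num [discK]) b hb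
    all_goals intros; simp [Qf, Vf, fnp, npABC, Vnp, c2]; try ring
  · refine wrap 2 0 5 10 0 0 id (fun _ => rfl) (by decide +kernel) (by norm_num) (by decide +kernel)
      ?_ ?_ ?_ ?_ ?_ (by norm_num [discK]) b hb
    all_goals intros; simp [Qf, Vf, fnp, npABC, Vnp, c2]; try ring
  · refine wrap 2 1 7 13 1 0 id (fun _ => rfl) (by decide +kernel) (by norm_num) (by decide +kernel)
      ?_ ?_ ?_ ?_ ?_ (by norm_num [discK]) b hb
    all_goals intros; simp [Qf, Vf, fnp, npABC, Vnp, c2]; try ring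
  · refine wrap 5 1 2 15 2 1 Prod.swap Prod.swap_swap (by decide +kernel) (by norm_num) (by decide +kernel)
      ?_ ?_ ?_ ?_ ?_ (by norm_num [discK]) b hb
    all_goals intros; simp [Qf, Vf, fnp, npABC, Vnp, c2]; try ring
  · refine wrap 2 0 11 22 0 0 id (fun _ => rfl) (by decide +kernel) (by norm_num) (by decide +kernel)
      ?_ ?_ ?_ ?_ ?_ (by norm_num [discK]) b hb
    all_goals intros; simp [Qf, Vf, fnp, npABC, Vnp, c2]; try ring
  · refine wrap 7 1 3 35 3 1 Prod.swap Prod.swap_swap (by decide +kernel) (by norm_num) (by decide +kernel)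
      ?_ ?_ ?_ ?_ ?_ (by norm_num [discK]) b hb
    all_goals intros; simp [Qf, Vf, fnp, npABC, Vnp, c2]; try ring
  · refine wrap 2 1 19 37 1 0 id (fun _ => rfl) (by decide +kernel) (by norm_num) (by decide +kernel)
      ?_ ?_ ?_ ?_ ?_ (by norm_num [discK]) b hb
    all_goals intros; simp [Qf, Vf, fnp, npABC, Vnp, c2]; try ring
  · refine wrap 3 1 5 51 1 0 id (fun _ => rfl) (by decide +kernel) (by norm_num) (by decide +kernel)
      ?_ ?_ ?_ ?_ ?_ (by norm_num [discK]) b hb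
    all_goals intros; simp [Qf, Vf, fnp, npABC, Vnp, c2]; try ring
  · refine wrap 2 0 29 58 0 0 id (fun _ => rfl) (by decide +kernel) (by norm_num) (by decide +kernel)
      ?_ ?_ ?_ ?_ ?_ (by norm_num [discK]) b hb
    all_goals intros; simp [Qf, Vf, fnp, npABC, Vnp, c2]; try ring
  · refine wrap 13 1 5 91 6 1 Prod.swap Prod.swap_swap (by decide +kernel) (by norm_num) (by decide +kernel)
      ?_ ?_ ?_ ?_ ?_ (by norm_num [discK]) b hb
    all_goals intros; simp [Qf, Vf, fnp, npABC, Vnp, c2]; try ring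
  · refine wrap 5 1 7 115 2 0 id (fun _ => rfl) (by decide +kernel) (by norm_num) (by decide +kernel)
      ?_ ?_ ?_ ?_ ?_ (by norm_num [discK]) b hb
    all_goals intros; simp [Qf, Vf, fnp, npABC, Vnp, c2]; try ring
  · refine wrap 3 1 11 123 1 0 id (fun _ => rfl) (by decide +kernel) (by norm_num) (by decide +kernel)
      ?_ ?_ ?_ ?_ ?_ (by norm_num [discK]) b hb
    all_goals intros; simp [Qf, Vf, fnp, npABC, Vnp, c2]; try ring
  · refine wrap 17 1 7 187 8 1 Prod.swap Prod.swap_swap (by decide +kernel) (by norm_num) (by decide +kernel)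
      ?_ ?_ ?_ ?_ ?_ (by norm_num [discK]) b hb
    all_goals intros; simp [Qf, Vf, fnp, npABC, Vnp, c2]; try ring
  · refine wrap 5 1 13 235 2 0 id (fun _ => rfl) (by decide +kernel) (by norm_num) (by decide +kernel)
      ?_ ?_ ?_ ?_ ?_ (by norm_num [discK]) b hb
    all_goals intros; simp [Qf, Vf, fnp, npABC, Vnp, c2]; try ring
  · refine wrap 3 1 23 267 1 0 id (fun _ => rfl) (by decide +kernel) (by norm_num) (by decide +kernel)
      ?_ ?_ ?_ ?_ ?_ (by norm_num [discK]) b hb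
    all_goals intros; simp [Qf, Vf, fnp, npABC, Vnp, c2]; try ring
  · refine wrap 31 1 11 403 15 1 Prod.swap Prod.swap_swap (by decide +kernel) (by norm_num) (by decide +kernel)
      ?_ ?_ ?_ ?_ ?_ (by norm_num [discK]) b hb
    all_goals intros; simp [Qf, Vf, fnp, npABC, Vnp, c2]; try ring
  · refine wrap 7 1 17 427 3 0 id (fun _ => rfl) (by decide +kernel) (by norm_num) (by decide +kernel)
      ?_ ?_ ?_ ?_ ?_ (by norm_num [discK]) b hb
    all_goals intros; simp [Qf, Vf, fnp, npABC, Vnp, c2]; try ring
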